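/- Let (Ω, Σ, μ) be a finite measure space, let T : L¹(μ) → L¹(μ) be a bounded linear operator, and let M : L¹(μ) → L¹(μ) be the modulus of T. Then for every f ∈ L¹(μ) with f ≥ 0 one has ‖M f‖₁ ≤ ‖T‖ · ‖f‖₁. -/

import Mathlib

open MeasureTheory

section AbstractLSpace

variable {E : Type*} [NormedAddCommGroup E] [Lattice E]

section Order

variable [IsOrderedAddMonoid E]

/-- The Riesz decomposition property: two decompositions of an element into two nonnegative
summands have a common refinement. -/
theorem exists_common_refinement {f₁ f₂ a b : E} (hf₁ : 0 ≤ f₁) (hf₂ : 0 ≤ f₂) (ha : 0 ≤ a)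
    (hb : 0 ≤ b) (h : f₁ + f₂ = a + b) :
    ∃ a₁ a₂ b₁ b₂ : E, 0 ≤ a₁ ∧ 0 ≤ a₂ ∧ 0 ≤ b₁ ∧ 0 ≤ b₂ ∧
      a = a₁ + a₂ ∧ b = b₁ + b₂ ∧ f₁ = a₁ + b₁ ∧ f₂ = a₂ + b₂ := by
  refine ⟨a ⊓ f₁, a - a ⊓ f₁, f₁ - a ⊓ f₁, b - (f₁ - a ⊓ f₁), le_inf ha hf₁,
    sub_nonneg.2 inf_le_left, sub_nonneg.2 inf_le_right, ?_, by abel, by abel, by abel, ?_⟩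
  · rw [sub_nonneg, sub_le_comm]
    refine le_inf ?_ (sub_le_self _ hb)
    rw [sub_le_iff_le_add, ← h]
    exact le_add_of_nonneg_right hf₂
  · rw [eq_sub_of_add_eq' h]
    abel

/-- In a Banach lattice whose norm is additive on the positive cone, a norm-bounded upward
directed set of nonnegative elements has an upper bound satisfying the same norm bound. -/
theorem exists_upperBound_norm_le [HasSolidNorm E] [CompleteSpace E]
    (hadd : ∀ x y : E, 0 ≤ x → 0 ≤ y → ‖x + y‖ = ‖x‖ + ‖y‖) {S : Set E} (hne : S.Nonempty)
    (hpos : ∀ d ∈ S, 0 ≤ d) (hdir : DirectedOn (· ≤ ·) S) {C : ℝ} (hC : ∀ d ∈ S, ‖d‖ ≤ C) :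
    ∃ u ∈ upperBounds S, ‖u‖ ≤ C := by
  have hbdd : BddAbove (norm '' S) := ⟨C, by rintro _ ⟨d, hd, rfl⟩; exact hC d hd⟩
  set s := sSup (norm '' S)
  have hclose (d c : E) (hd : d ∈ S) (hc : c ∈ S) (hdc : d ≤ c) : ‖c - d‖ ≤ s - ‖d‖ := by
    have h := hadd d (c - d) (hpos d hd) (sub_nonneg.2 hdc)
    rw [add_sub_cancel] at h
    linarith [le_csSup hbdd (Set.mem_image_of_mem norm hc)]
  have hex (n : ℕ) : ∃ d ∈ S, s - ‖d‖ ≤ 1 / ((n : ℝ) + 1) := by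
    obtain ⟨_, ⟨d, hd, rfl⟩, h⟩ := exists_lt_of_lt_csSup (hne.image norm)
      (sub_lt_self s (Nat.one_div_pos_of_nat (α := ℝ) (n := n)))
    exact ⟨d, hd, by linarith⟩
  choose d hd hds using hex
  have hlim : Filter.Tendsto (fun n : ℕ ↦ 1 / ((n : ℝ) + 1)) Filter.atTop (nhds 0) :=
    tendsto_one_div_add_atTop_nhds_zero_nat
  have hcauchy : CauchySeq d := by
    refine cauchySeq_of_le_tendsto_0 (fun n : ℕ ↦ 2 * (1 / ((n : ℝ) + 1))) (fun m n N hm hn ↦ ?_)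
      (by simpa using hlim.const_mul 2)
    obtain ⟨c, hc, hmc, hnc⟩ := hdir _ (hd m) _ (hd n)
    have h₁ := (hclose _ c (hd m) hc hmc).trans
      ((hds m).trans (Nat.one_div_le_one_div (α := ℝ) hm))
    have h₂ := (hclose _ c (hd n) hc hnc).trans
      ((hds n).trans (Nat.one_div_le_one_div (α := ℝ) hn))
    have h₃ := dist_triangle_left (d m) (d n) c
    rw [dist_eq_norm c, dist_eq_norm c] at h₃
    linarith
  obtain ⟨u, hu⟩ := cauchySeq_tendsto_of_complete hcauchy
  refine ⟨u, fun e he ↦ ?_, le_of_tendsto hu.norm (.of_forall fun n ↦ hC _ (hd n))⟩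
  choose c hc hdc hec using fun n ↦ hdir _ (hd n) _ he
  have hcd : Filter.Tendsto (fun n ↦ c n - d n) Filter.atTop (nhds 0) :=
    squeeze_zero_norm (fun n ↦ (hclose _ _ (hd n) (hc n) (hdc n)).trans (hds n)) hlim
  have hcu : Filter.Tendsto c Filter.atTop (nhds u) := by simpa using hcd.add hu
  exact ge_of_tendsto hcu (.of_forall hec)

end Order

variable [NormedSpace ℝ E]

/-- `IsPartitionSum T f d` says that `d = ∑ |T fᵢ|` for some finite decomposition `f = ∑ fᵢ` of
`f` into nonnegative elements. -/
inductive IsPartitionSum (T : E →L[ℝ] E) : E → E → Prop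
  | abs_apply (f : E) (hf : 0 ≤ f) : IsPartitionSum T f |T f|
  | add (f₁ f₂ d₁ d₂ : E) (h₁ : IsPartitionSum T f₁ d₁) (h₂ : IsPartitionSum T f₂ d₂) :
      IsPartitionSum T (f₁ + f₂) (d₁ + d₂)

variable [IsOrderedAddMonoid E]

namespace IsPartitionSum

variable {T : E →L[ℝ] E} {f d e : E}

theorem nonneg_left (h : IsPartitionSum T f d) : 0 ≤ f := by
  induction h with
  | abs_apply f hf => exact hf
  | add f₁ f₂ d₁ d₂ _ _ ih₁ ih₂ => exact add_nonneg ih₁ ih₂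

theorem nonneg_right (h : IsPartitionSum T f d) : 0 ≤ d := by
  induction h with
  | abs_apply f hf => exact abs_nonneg _
  | add f₁ f₂ d₁ d₂ _ _ ih₁ ih₂ => exact add_nonneg ih₁ ih₂

theorem abs_apply_le (h : IsPartitionSum T f d) : |T f| ≤ d := by
  induction h with
  | abs_apply f hf => exact le_rfl
  | add f₁ f₂ d₁ d₂ _ _ ih₁ ih₂ =>
    rw [map_add]
    exact (abs_add_le _ _).trans (add_le_add ih₁ ih₂)

theorem exists_split (h : IsPartitionSum T f d) :
    ∀ a b : E, 0 ≤ a → 0 ≤ b → f = a + b →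
      ∃ d₁ d₂, IsPartitionSum T a d₁ ∧ IsPartitionSum T b d₂ ∧ d ≤ d₁ + d₂ := by
  induction h with
  | abs_apply f hf =>
    rintro a b ha hb rfl
    refine ⟨_, _, abs_apply a ha, abs_apply b hb, ?_⟩
    rw [map_add]
    exact abs_add_le _ _
  | add f₁ f₂ d₁ d₂ h₁ h₂ ih₁ ih₂ =>
    intro a b ha hb hab
    obtain ⟨a₁, a₂, b₁, b₂, ha₁, ha₂, hb₁, hb₂, rfl, rfl, hf₁, hf₂⟩ :=
      exists_common_refinement h₁.nonneg_left h₂.nonneg_left ha hb hab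
    obtain ⟨u₁, v₁, hu₁, hv₁, hd₁⟩ := ih₁ a₁ b₁ ha₁ hb₁ hf₁
    obtain ⟨u₂, v₂, hu₂, hv₂, hd₂⟩ := ih₂ a₂ b₂ ha₂ hb₂ hf₂
    refine ⟨_, _, add _ _ _ _ hu₁ hu₂, add _ _ _ _ hv₁ hv₂, ?_⟩
    rw [add_add_add_comm]
    exact add_le_add hd₁ hd₂

theorem exists_ge (hd : IsPartitionSum T f d) :
    ∀ e, IsPartitionSum T f e → ∃ c, IsPartitionSum T f c ∧ d ≤ c ∧ e ≤ c := by
  induction hd with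
  | abs_apply f hf => exact fun e he ↦ ⟨e, he, he.abs_apply_le, le_rfl⟩
  | add f₁ f₂ d₁ d₂ h₁ h₂ ih₁ ih₂ =>
    intro e he
    obtain ⟨e₁, e₂, he₁, he₂, hle⟩ := he.exists_split f₁ f₂ h₁.nonneg_left h₂.nonneg_left rfl
    obtain ⟨c₁, hc₁, hdc₁, hec₁⟩ := ih₁ e₁ he₁
    obtain ⟨c₂, hc₂, hdc₂, hec₂⟩ := ih₂ e₂ he₂
    exact ⟨_, add _ _ _ _ hc₁ hc₂, add_le_add hdc₁ hdc₂, hle.trans (add_le_add hec₁ hec₂)⟩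

theorem exists_abs_apply_le {g : E} (hg : |g| ≤ f) :
    ∃ d, IsPartitionSum T f d ∧ |T g| ≤ d := by
  have hf : f = g⁺ + g⁻ + (f - |g|) := by rw [posPart_add_negPart]; abel
  refine ⟨|T g⁺| + |T g⁻| + |T (f - |g|)|, ?_, ?_⟩
  · nth_rewrite 1 [hf]
    exact add _ _ _ _ (add _ _ _ _ (abs_apply _ (posPart_nonneg g))
      (abs_apply _ (negPart_nonneg g))) (abs_apply _ (sub_nonneg.2 hg))
  · calc |T g| = |T g⁺ + -T g⁻| := by
          rw [← sub_eq_add_neg, ← map_sub, posPart_sub_negPart]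
      _ ≤ |T g⁺| + |T g⁻| := (abs_add_le _ _).trans_eq (by rw [abs_neg])
      _ ≤ _ := le_add_of_nonneg_right (abs_nonneg _)

variable [HasSolidNorm E]

theorem norm_le (hadd : ∀ x y : E, 0 ≤ x → 0 ≤ y → ‖x + y‖ = ‖x‖ + ‖y‖)
    (h : IsPartitionSum T f d) : ‖d‖ ≤ ‖T‖ * ‖f‖ := by
  induction h with
  | abs_apply f hf => exact (norm_abs_eq_norm _).trans_le (T.le_opNorm f)
  | add f₁ f₂ d₁ d₂ h₁ h₂ ih₁ ih₂ =>
    rw [hadd _ _ h₁.nonneg_left h₂.nonneg_left, mul_add]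
    exact (norm_add_le _ _).trans (add_le_add ih₁ ih₂)

end IsPartitionSum

end AbstractLSpace

theorem MeasureTheory.L1.norm_add_of_nonneg {Ω : Type*} [MeasurableSpace Ω] {μ : Measure Ω}
    (f g : Lp ℝ 1 μ) (hf : 0 ≤ f) (hg : 0 ≤ g) : ‖f + g‖ = ‖f‖ + ‖g‖ := by
  rw [L1.norm_eq_integral_norm, L1.norm_eq_integral_norm, L1.norm_eq_integral_norm,
    ← MeasureTheory.integral_add (L1.integrable_coeFn f).norm (L1.integrable_coeFn g).norm]
  refine MeasureTheory.integral_congr_ae ?_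
  filter_upwards [Lp.coeFn_add f g, (Lp.coeFn_nonneg f).2 hf, (Lp.coeFn_nonneg g).2 hg]
    with x hx hfx hgx
  rw [hx, Pi.add_apply, Real.norm_of_nonneg hfx, Real.norm_of_nonneg hgx,
    Real.norm_of_nonneg (add_nonneg hfx hgx)]

/-- If `M` is the modulus of a bounded linear operator `T` on `L¹(μ)` of a finite measure
space, then `‖M f‖₁ ≤ ‖T‖ * ‖f‖₁` for every `f ≥ 0`. -/
theorem norm_modulus_apply_le {Ω : Type*} [MeasurableSpace Ω] (μ : Measure Ω)
    [IsFiniteMeasure μ] (T M : Lp ℝ 1 μ →L[ℝ] Lp ℝ 1 μ)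
    (hMpos : ∀ f : Lp ℝ 1 μ, 0 ≤ f → 0 ≤ M f)
    (hMmod : ∀ f : Lp ℝ 1 μ, 0 ≤ f →
      IsLUB {h : Lp ℝ 1 μ | ∃ g : Lp ℝ 1 μ, |g| ≤ f ∧ h = |T g|} (M f)) :
    ∀ f : Lp ℝ 1 μ, 0 ≤ f → ‖M f‖ ≤ ‖T‖ * ‖f‖ := by
  intro f hf
  obtain ⟨u, hu, hnorm⟩ := exists_upperBound_norm_le L1.norm_add_of_nonneg
    (S := {d | IsPartitionSum T f d}) ⟨_, .abs_apply f hf⟩ (fun d hd ↦ hd.nonneg_right)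
    (fun d hd e he ↦ hd.exists_ge e he) (fun d hd ↦ hd.norm_le L1.norm_add_of_nonneg)
  have hMu : M f ≤ u := by
    refine (hMmod f hf).2 ?_
    rintro _ ⟨g, hg, rfl⟩
    obtain ⟨d, hd, hle⟩ := IsPartitionSum.exists_abs_apply_le (T := T) hg
    exact hle.trans (hu hd)
  refine le_trans (norm_le_norm_of_abs_le_abs ?_) hnorm
  rwa [abs_of_nonneg (hMpos f hf), abs_of_nonneg ((hMpos f hf).trans hMu)]
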